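/- With the same structure and W = αξ + βv + γφv as above (α = -b/√(a⁴+b²), γ = a/√(a⁴+b²), β arbitrary), the unique vector N = λξ + μv + νφv satisfying g(v,N)=1, g(N,N)=0, g(N,W)=0 is given by λ = (a³ + βb√(a⁴+b²))/(a⁴+b²), μ = -(a² + β²(a⁴+b²))/(2(a⁴+b²)), ν = (b - βa√(a⁴+b²))/(a⁴+b²). -/

import Mathlib

/-- With `W = α•ξ + β•v + γ•(φ v)` where `α = -b/√(a⁴+b²)`, `γ = a/√(a⁴+b²)`,
the unique `N = λ•ξ + μ•v + ν•(φ v)` with `g v N = 1`, `g N N = 0`, `g N W = 0` has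
`λ = (a³ + βb√(a⁴+b²))/(a⁴+b²)`, `μ = -(a² + β²(a⁴+b²))/(2(a⁴+b²))`,
`ν = (b - βa√(a⁴+b²))/(a⁴+b²)`. -/
theorem null_transversal_unique
    {V : Type*} [AddCommGroup V] [Module ℝ V]
    (g : LinearMap.BilinForm ℝ V) (hsym : ∀ X Y : V, g X Y = g Y X)
    (v ξ w : V) (a b β : ℝ) (ha : a ≠ 0)
    (hvv : g v v = 0) (hvξ : g v ξ = a) (hvw : g v w = b)
    (hξξ : g ξ ξ = 1) (hξw : g ξ w = 0) (hww : g w w = a ^ 2)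
    (W : V)
    (hW : W = (-b / Real.sqrt (a ^ 4 + b ^ 2)) • ξ + β • v +
      (a / Real.sqrt (a ^ 4 + b ^ 2)) • w) :
    ∀ lam mu nu : ℝ,
      (g v (lam • ξ + mu • v + nu • w) = 1 ∧
       g (lam • ξ + mu • v + nu • w) (lam • ξ + mu • v + nu • w) = 0 ∧
       g (lam • ξ + mu • v + nu • w) W = 0) ↔
      (lam = (a ^ 3 + β * b * Real.sqrt (a ^ 4 + b ^ 2)) / (a ^ 4 + b ^ 2) ∧
       mu = -((a ^ 2 + β ^ 2 * (a ^ 4 + b ^ 2)) / (2 * (a ^ 4 + b ^ 2))) ∧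
       nu = (b - β * a * Real.sqrt (a ^ 4 + b ^ 2)) / (a ^ 4 + b ^ 2)) := by
  intro lam mu nu
  have hD : 0 < a ^ 4 + b ^ 2 := by positivity
  have hs : 0 < Real.sqrt (a ^ 4 + b ^ 2) := Real.sqrt_pos.mpr hD
  have hs2 : Real.sqrt (a ^ 4 + b ^ 2) ^ 2 = a ^ 4 + b ^ 2 := Real.sq_sqrt hD.le
  have hξv : g ξ v = a := by rw [hsym, hvξ]
  have hwv : g w v = b := by rw [hsym, hvw]
  have hwξ : g w ξ = 0 := by rw [hsym, hξw]
  subst hW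
  simp only [map_add, map_smul, LinearMap.add_apply, LinearMap.smul_apply, smul_eq_mul,
    hvv, hvξ, hvw, hξξ, hξw, hww, hξv, hwv, hwξ]
  generalize Real.sqrt (a ^ 4 + b ^ 2) = s at *
  have hs0 : s ≠ 0 := hs.ne'
  rw [← hs2]
  constructor
  · rintro ⟨h1, h2, h3⟩
    have h3' : -b * lam + a ^ 3 * nu = -β * s := by
      field_simp at h3
      linear_combination h3 - β * s * h1
    have hl : lam = (a ^ 3 + β * b * s) / s ^ 2 := by
      rw [eq_div_iff (by positivity)]
      linear_combination lam * hs2 + a ^ 3 * h1 - b * h3'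
    have hn : nu = (b - β * a * s) / s ^ 2 := by
      rw [eq_div_iff (by positivity)]
      linear_combination nu * hs2 + b * h1 + a * h3'
    refine ⟨hl, ?_, hn⟩
    have hm : mu = -(lam ^ 2 + a ^ 2 * nu ^ 2) / 2 := by
      linear_combination h2 / 2 - mu * h1
    rw [hm, hl, hn]
    field_simp
    linear_combination (-a ^ 2 - β ^ 2 * s ^ 2) * (-hs2)
  · rintro ⟨hl, hm, hn⟩
    have h1 : lam * a + nu * b = 1 := by
      rw [hl, hn]
      field_simp
      linear_combination -hs2
    have h3' : -b * lam + a ^ 3 * nu = -β * s := by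
      rw [hl, hn]
      field_simp
      linear_combination β * s * hs2
    have hm' : mu = -(lam ^ 2 + a ^ 2 * nu ^ 2) / 2 := by
      rw [hm, hl, hn]
      field_simp
      linear_combination (-a ^ 2 - β ^ 2 * s ^ 2) * hs2
    refine ⟨by linear_combination h1, ?_, ?_⟩
    · linear_combination 2 * hm' + 2 * mu * h1
    · field_simp
      linear_combination h3' + β * s * h1
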